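/- arXiv:1705.09177 — 7 statements merged into one kernel-verified Lean document; each statement's English description precedes it below -/
import Mathlib

section
/- Let G be a finite simple graph whose vertex set is the union of two cliques, and suppose that the vertex set of G is not itself a clique. Then G is well-covered if and only if G has no universal vertex, i.e., no vertex adjacent to all other vertices of G. -/
/-- A set of vertices is independent if no two of its vertices are adjacent. -/
def SimpleGraph.IsIndep {V : Type*} (G : SimpleGraph V) (s : Set V) : Prop :=
  s.Pairwise fun u v => ¬ G.Adj u v

/-- A maximal independent set: independent and not properly contained in another
independent set. -/
def SimpleGraph.IsMaxIndep {V : Type*} (G : SimpleGraph V) (s : Set V) : Prop :=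
  G.IsIndep s ∧ ∀ t : Set V, G.IsIndep t → s ⊆ t → s = t

/-- A graph is well-covered if all its maximal independent sets have the same
cardinality. -/
def SimpleGraph.WellCovered {V : Type*} (G : SimpleGraph V) : Prop :=
  ∀ s t : Set V, G.IsMaxIndep s → G.IsMaxIndep t → s.ncard = t.ncard

/-- An `(r, ℓ)`-graph: the vertex set can be partitioned into `r` independent sets
and `ℓ` cliques (any of which may be empty): every vertex belongs to exactly one
of the parts. -/
def SimpleGraph.IsRLGraph {V : Type*} (G : SimpleGraph V) (r ℓ : ℕ) : Prop :=
  ∃ (S : Fin r → Set V) (K : Fin ℓ → Set V),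
    (∀ i, G.IsIndep (S i)) ∧ (∀ j, G.IsClique (K j)) ∧
    ∀ v : V, ∃! p : Fin r ⊕ Fin ℓ, v ∈ Sum.elim S K p

/-- If two cliques cover the graph, no three distinct vertices are pairwise nonadjacent. -/
theorem SimpleGraph.IsIndep.eq_or_eq_of_cover {V : Type*} {G : SimpleGraph V} {K₁ K₂ t : Set V}
    (h1 : G.IsClique K₁) (h2 : G.IsClique K₂) (hcover : K₁ ∪ K₂ = Set.univ)
    (ht : G.IsIndep t) {a b x : V} (ha : a ∈ t) (hb : b ∈ t) (hx : x ∈ t) (hab : a ≠ b) :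
    x = a ∨ x = b := by
  by_contra! h
  have mem (v : V) : v ∈ K₁ ∨ v ∈ K₂ := by
    rw [← Set.mem_union, hcover]
    trivial
  have notMem₁ {u v : V} (hu : u ∈ t) (hv : v ∈ t) (huv : u ≠ v) (hu₁ : u ∈ K₁) : v ∉ K₁ :=
    fun hv₁ => ht hu hv huv (h1 hu₁ hv₁ huv)
  have notMem₂ {u v : V} (hu : u ∈ t) (hv : v ∈ t) (huv : u ≠ v) (hu₂ : u ∈ K₂) : v ∉ K₂ :=
    fun hv₂ => ht hu hv huv (h2 hu₂ hv₂ huv)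
  have := notMem₁ hx ha h.1
  have := notMem₁ hx hb h.2
  have := notMem₁ ha hb hab
  have := notMem₂ hx ha h.1
  have := notMem₂ hx hb h.2
  have := notMem₂ ha hb hab
  have := mem a
  have := mem b
  have := mem x
  tauto

theorem SimpleGraph.isIndep_pair {V : Type*} {G : SimpleGraph V} {a b : V} (h : ¬ G.Adj a b) :
    G.IsIndep {a, b} :=
  Set.pairwise_pair.2 fun _ => ⟨h, fun hba => h hba.symm⟩

/-- If two cliques cover the graph, any two distinct nonadjacent vertices form a maximal
independent set. -/
theorem SimpleGraph.isMaxIndep_pair_of_cover {V : Type*} {G : SimpleGraph V} {K₁ K₂ : Set V}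
    (h1 : G.IsClique K₁) (h2 : G.IsClique K₂) (hcover : K₁ ∪ K₂ = Set.univ)
    {a b : V} (hab : a ≠ b) (h : ¬ G.Adj a b) : G.IsMaxIndep {a, b} := by
  refine ⟨isIndep_pair h, fun t ht hsub => hsub.antisymm fun x hx => ?_⟩
  exact ht.eq_or_eq_of_cover h1 h2 hcover (hsub (by simp)) (hsub (by simp)) hx hab

/-- A universal vertex forms a maximal independent set on its own. -/
theorem SimpleGraph.isMaxIndep_singleton {V : Type*} {G : SimpleGraph V} {v : V}
    (hv : ∀ w : V, w ≠ v → G.Adj v w) : G.IsMaxIndep {v} := by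
  refine ⟨Set.pairwise_singleton _ _, fun t ht hsub => hsub.antisymm fun x hx => ?_⟩
  by_contra hxv
  exact ht (hsub rfl) hx (Ne.symm hxv) (hv x hxv)

/-- If two cliques cover a nonempty graph without universal vertex, every maximal independent
set has two elements. -/
theorem SimpleGraph.IsMaxIndep.ncard_eq_two {V : Type*} [Nonempty V] {G : SimpleGraph V}
    {K₁ K₂ s : Set V}
    (h1 : G.IsClique K₁) (h2 : G.IsClique K₂) (hcover : K₁ ∪ K₂ = Set.univ)
    (huniv : ¬ ∃ v : V, ∀ w : V, w ≠ v → G.Adj v w) (hs : G.IsMaxIndep s) : s.ncard = 2 := by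
  obtain ⟨a, ha⟩ : s.Nonempty := by
    by_contra! hempty
    subst hempty
    obtain ⟨x⟩ := ‹Nonempty V›
    exact Set.singleton_ne_empty x
      (hs.2 {x} (Set.pairwise_singleton _ _) (Set.empty_subset _)).symm
  obtain ⟨c, hc, hca⟩ : ∃ c ∈ s, c ≠ a := by
    by_contra! hall
    push Not at huniv
    obtain ⟨b, hba, hadj⟩ := huniv a
    have hsb := hs.2 {a, b} (isIndep_pair hadj) fun x hx => Or.inl (hall x hx)
    exact hba (hall b (hsb ▸ by simp))
  have hpair := (isMaxIndep_pair_of_cover h1 h2 hcover hca.symm (hs.1 ha hc hca.symm)).2 s hs.1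
    (Set.insert_subset ha (Set.singleton_subset_iff.2 hc))
  rw [← hpair, Set.ncard_pair hca.symm]

theorem stmt_2 {V : Type*} [Fintype V] (G : SimpleGraph V) (K₁ K₂ : Set V)
    (h1 : G.IsClique K₁) (h2 : G.IsClique K₂) (hcover : K₁ ∪ K₂ = Set.univ)
    (hnotclique : ¬ G.IsClique (Set.univ : Set V)) :
    G.WellCovered ↔ ¬ ∃ v : V, ∀ w : V, w ≠ v → G.Adj v w := by
  obtain ⟨a, b, hab, hadj⟩ : ∃ a b, a ≠ b ∧ ¬ G.Adj a b := by
    by_contra! h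
    exact hnotclique fun a _ b _ hab => h a b hab
  constructor
  · rintro hwc ⟨v, hv⟩
    have hcard := hwc _ _ (SimpleGraph.isMaxIndep_singleton hv)
      (SimpleGraph.isMaxIndep_pair_of_cover h1 h2 hcover hab hadj)
    rw [Set.ncard_singleton, Set.ncard_pair hab] at hcard
    omega
  · intro huniv s t hs ht
    have : Nonempty V := ⟨a⟩
    rw [hs.ncard_eq_two h1 h2 hcover huniv, ht.ncard_eq_two h1 h2 hcover huniv]
end

section
/- Let G be a well-covered finite simple graph whose vertex set is partitioned into an independent set S and a clique K. Then every vertex x ∈ K has at most one neighbor in S. -/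
/-- In a graph partitioned into an independent set `S` and a clique `K`, a vertex of `K`
together with its non-neighbors in `S` forms a maximal independent set. -/
theorem SimpleGraph.isMaxIndep_insert_diff_neighborSet {V : Type*} (G : SimpleGraph V)
    {S K : Set V} (hS : G.IsIndep S) (hK : G.IsClique K) (hcover : S ∪ K = Set.univ)
    {x : V} (hx : x ∈ K) : G.IsMaxIndep (insert x (S \ G.neighborSet x)) := by
  refine ⟨?_, fun t ht hsub => hsub.antisymm fun v hv => ?_⟩
  · rintro u (rfl | ⟨hu, hxu⟩) v (rfl | ⟨hv, hxv⟩) huv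
    · exact absurd rfl huv
    · exact hxv
    · exact fun h => hxu h.symm
    · exact hS hu hv huv
  · by_cases hvx : v = x
    · exact Or.inl hvx
    have hxv : ¬ G.Adj x v := ht (hsub (Set.mem_insert _ _)) hv (Ne.symm hvx)
    rcases (hcover ▸ Set.mem_univ v : v ∈ S ∪ K) with hvS | hvK
    · exact Or.inr ⟨hvS, hxv⟩
    · exact absurd (hK hx hvK (Ne.symm hvx)) hxv

theorem stmt_3 {V : Type*} [Fintype V] (G : SimpleGraph V) (S K : Set V)
    (hS : G.IsIndep S) (hK : G.IsClique K) (hdisj : Disjoint S K)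
    (hcover : S ∪ K = Set.univ) (hwc : G.WellCovered) :
    ∀ x ∈ K, (S ∩ G.neighborSet x).ncard ≤ 1 := by
  intro x hx
  have hcard : ∀ y ∈ K, (insert y (S \ G.neighborSet y)).ncard =
      (S \ G.neighborSet y).ncard + 1 :=
    fun y hy => Set.ncard_insert_of_notMem
      (fun h => Set.disjoint_left.mp hdisj h.1 hy) (Set.toFinite _)
  have hsum := Set.ncard_inter_add_ncard_sdiff_eq_ncard S (G.neighborSet x) (Set.toFinite S)
  have hxmax := G.isMaxIndep_insert_diff_neighborSet hS hK hcover hx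
  by_cases hmax : G.IsMaxIndep S
  · have := hwc _ _ hxmax hmax
    rw [hcard x hx] at this
    omega
  · obtain ⟨t, ht, hSt, hne⟩ : ∃ t, G.IsIndep t ∧ S ⊆ t ∧ S ≠ t := by
      by_contra! h
      exact hmax ⟨hS, h⟩
    obtain ⟨y, hyt, hyS⟩ := Set.exists_of_ssubset (hSt.ssubset_of_ne hne)
    have hyK : y ∈ K := (hcover ▸ Set.mem_univ y : y ∈ S ∪ K).resolve_left hyS
    have hdiff : S \ G.neighborSet y = S := by
      refine sdiff_eq_left.mpr (Set.disjoint_left.mpr fun v hv hyv => ?_)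
      exact ht hyt (hSt hv) (fun h => hyS (h ▸ hv)) hyv
    have := hwc _ _ hxmax (G.isMaxIndep_insert_diff_neighborSet hS hK hcover hyK)
    rw [hcard x hx, hcard y hyK, hdiff] at this
    omega
end

section
/- A finite simple graph G is (1,1)-well-covered if and only if G admits a partition of its vertex set into an independent set S and a clique K such that either every vertex of K has no neighbor in S, or every vertex of K has exactly one neighbor in S. -/
namespace SimpleGraph

variable {V : Type*} {G : SimpleGraph V} {S K : Set V}

lemma isRLGraph_one_one_iff :
    G.IsRLGraph 1 1 ↔
      ∃ S K : Set V, Disjoint S K ∧ S ∪ K = Set.univ ∧ G.IsIndep S ∧ G.IsClique K := by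
  constructor
  · rintro ⟨S, K, hS, hK, hp⟩
    refine ⟨S 0, K 0, ?_, ?_, hS 0, hK 0⟩
    · rw [Set.disjoint_left]
      intro v hvS hvK
      have := (hp v).unique (y₁ := Sum.inl 0) (y₂ := Sum.inr 0) hvS hvK
      cases this
    · ext v
      obtain ⟨p, hv, -⟩ := hp v
      rcases p with i | j
      · obtain rfl := Subsingleton.elim i 0
        simpa using Or.inl hv
      · obtain rfl := Subsingleton.elim j 0
        simpa using Or.inr hv
  · rintro ⟨S, K, hd, hu, hS, hK⟩
    refine ⟨fun _ => S, fun _ => K, fun _ => hS, fun _ => hK, fun v => ?_⟩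
    have hv : v ∈ S ∪ K := hu ▸ Set.mem_univ v
    rcases hv with hv | hv
    · refine ⟨Sum.inl 0, hv, ?_⟩
      rintro (i | j) h
      · exact congrArg _ (Subsingleton.elim _ _)
      · exact (Set.disjoint_left.1 hd hv h).elim
    · refine ⟨Sum.inr 0, hv, ?_⟩
      rintro (i | j) h
      · exact (Set.disjoint_left.1 hd h hv).elim
      · exact congrArg _ (Subsingleton.elim _ _)

lemma IsIndep.insert_diff_neighborSet (hS : G.IsIndep S) (x : V) :
    G.IsIndep (insert x (S \ G.neighborSet x)) := by
  rintro u (rfl | ⟨hu, hux⟩) v (rfl | ⟨hv, hvx⟩) huv h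
  · exact huv rfl
  · exact hvx h
  · exact hux h.symm
  · exact hS hu hv huv h

lemma IsIndep.subset_insert_diff_neighborSet {t : Set V} {x : V} (hu : S ∪ K = Set.univ)
    (hK : G.IsClique K) (hx : x ∈ K) (ht : G.IsIndep t) (hxt : x ∈ t) :
    t ⊆ insert x (S \ G.neighborSet x) := by
  intro v hv
  by_cases hvx : v = x
  · exact Or.inl hvx
  have hvn : ¬ G.Adj x v := ht hxt hv (Ne.symm hvx)
  rcases (hu ▸ Set.mem_univ v : v ∈ S ∪ K) with hvS | hvK
  · exact Or.inr ⟨hvS, hvn⟩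
  · exact (hvn (hK hx hvK (Ne.symm hvx))).elim

lemma isMaxIndep_insert_diff_neighborSet_s4 {x : V} (hu : S ∪ K = Set.univ)
    (hS : G.IsIndep S) (hK : G.IsClique K) (hx : x ∈ K) :
    G.IsMaxIndep (insert x (S \ G.neighborSet x)) :=
  ⟨hS.insert_diff_neighborSet x, fun _ ht h =>
    h.antisymm (ht.subset_insert_diff_neighborSet hu hK hx (h (Set.mem_insert _ _)))⟩

lemma IsMaxIndep.eq_or_eq_insert {t : Set V} (hu : S ∪ K = Set.univ)
    (hS : G.IsIndep S) (hK : G.IsClique K) (ht : G.IsMaxIndep t) :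
    t = S ∨ ∃ x ∈ K, t = insert x (S \ G.neighborSet x) := by
  by_cases h : ∃ x ∈ K, x ∈ t
  · obtain ⟨x, hx, hxt⟩ := h
    exact Or.inr ⟨x, hx, ht.2 _ (hS.insert_diff_neighborSet x)
      (ht.1.subset_insert_diff_neighborSet hu hK hx hxt)⟩
  · refine Or.inl (ht.2 S hS fun v hv => ?_)
    rcases (hu ▸ Set.mem_univ v : v ∈ S ∪ K) with hvS | hvK
    · exact hvS
    · exact (h ⟨v, hvK, hv⟩).elim

lemma ncard_insert_diff_neighborSet [Finite V] {x : V} (hx : x ∉ S) :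
    (insert x (S \ G.neighborSet x)).ncard + (S ∩ G.neighborSet x).ncard = S.ncard + 1 := by
  rw [Set.ncard_insert_of_notMem fun h => hx h.1]
  have := Set.ncard_inter_add_ncard_sdiff_eq_ncard S (G.neighborSet x)
  omega

lemma IsMaxIndep.inter_neighborSet_nonempty {x : V} (hS : G.IsMaxIndep S) (hx : x ∉ S) :
    (S ∩ G.neighborSet x).Nonempty := by
  by_contra h
  have hdiff : S \ G.neighborSet x = S :=
    sdiff_eq_left.2 (Set.disjoint_iff_inter_eq_empty.2 (Set.not_nonempty_iff_eq_empty.1 h))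
  have hins := hS.1.insert_diff_neighborSet x
  rw [hdiff] at hins
  exact hx (hS.2 _ hins (Set.subset_insert _ _) ▸ Set.mem_insert x S)

lemma IsIndep.isMaxIndep_of_inter_neighborSet_nonempty (hu : S ∪ K = Set.univ)
    (hS : G.IsIndep S) (h : ∀ x ∈ K, (S ∩ G.neighborSet x).Nonempty) : G.IsMaxIndep S := by
  refine ⟨hS, fun t ht hSt => hSt.antisymm fun v hv => ?_⟩
  rcases (hu ▸ Set.mem_univ v : v ∈ S ∪ K) with hvS | hvK
  · exact hvS
  · obtain ⟨w, hwS, hw⟩ := h v hvK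
    exact (ht hv (hSt hwS) (G.ne_of_adj hw) hw).elim

lemma wellCovered_iff_of_split [Finite V] (hd : Disjoint S K) (hu : S ∪ K = Set.univ)
    (hS : G.IsIndep S) (hK : G.IsClique K) :
    G.WellCovered ↔
      (∀ x ∈ K, S ∩ G.neighborSet x = ∅) ∨ ∀ x ∈ K, (S ∩ G.neighborSet x).ncard = 1 := by
  have hKS : ∀ x ∈ K, x ∉ S := fun x hx hxS => Set.disjoint_left.1 hd hxS hx
  have hcard := fun x hx => ncard_insert_diff_neighborSet (G := G) (hKS x hx)
  have hmax := fun x hx => isMaxIndep_insert_diff_neighborSet_s4 (x := x) hu hS hK hx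
  constructor
  · intro hw
    by_cases h : ∀ x ∈ K, (S ∩ G.neighborSet x).Nonempty
    · right
      intro x hx
      have h₁ := hw _ _ (hmax x hx) (hS.isMaxIndep_of_inter_neighborSet_nonempty hu h)
      have h₂ := hcard x hx
      omega
    · left
      push Not at h
      obtain ⟨y, hy, hyS⟩ := h
      intro x hx
      have h₁ := hw _ _ (hmax x hx) (hmax y hy)
      have h₂ := hcard x hx
      have h₃ := hcard y hy
      rw [hyS, Set.ncard_empty] at h₃
      rw [← Set.ncard_eq_zero]
      omega
  · rintro (h | h) s t hs ht
    · have hSmax : ∀ x ∈ K, ¬ G.IsMaxIndep S := fun x hx hSm =>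
        (hSm.inter_neighborSet_nonempty (hKS x hx)).ne_empty (h x hx)
      have hc : ∀ x ∈ K, (insert x (S \ G.neighborSet x)).ncard = S.ncard + 1 := by
        intro x hx
        simpa [h x hx] using hcard x hx
      rcases hs.eq_or_eq_insert hu hS hK with rfl | ⟨x, hx, rfl⟩ <;>
        rcases ht.eq_or_eq_insert hu hS hK with rfl | ⟨y, hy, rfl⟩
      · rfl
      · exact (hSmax y hy hs).elim
      · exact (hSmax x hx ht).elim
      · rw [hc x hx, hc y hy]
    · have hc : ∀ t, G.IsMaxIndep t → t.ncard = S.ncard := by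
        intro t ht
        rcases ht.eq_or_eq_insert hu hS hK with rfl | ⟨x, hx, rfl⟩
        · rfl
        · have h₁ := hcard x hx
          have h₂ := h x hx
          omega
      rw [hc s hs, hc t ht]

end SimpleGraph

theorem stmt_4 {V : Type*} [Fintype V] (G : SimpleGraph V) :
    (G.IsRLGraph 1 1 ∧ G.WellCovered) ↔
      ∃ S K : Set V, Disjoint S K ∧ S ∪ K = Set.univ ∧
        G.IsIndep S ∧ G.IsClique K ∧
        ((∀ x ∈ K, S ∩ G.neighborSet x = ∅) ∨
          (∀ x ∈ K, (S ∩ G.neighborSet x).ncard = 1)) := by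
  rw [SimpleGraph.isRLGraph_one_one_iff]
  constructor
  · rintro ⟨⟨S, K, hd, hu, hS, hK⟩, hw⟩
    exact ⟨S, K, hd, hu, hS, hK, (SimpleGraph.wellCovered_iff_of_split hd hu hS hK).1 hw⟩
  · rintro ⟨S, K, hd, hu, hS, hK, h⟩
    exact ⟨⟨S, K, hd, hu, hS, hK⟩, (SimpleGraph.wellCovered_iff_of_split hd hu hS hK).2 h⟩
end

section
/- Let G be a finite simple graph with n vertices v_1, v_2, …, v_n, and let H be the graph obtained from G by adding n new vertices u_1, u_2, …, u_n together with the pendant edges v_i u_i for each i ∈ {1,…,n}. Then H is well-covered, and every maximal independent set of H has cardinality exactly n. -/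
/-- A maximal independent set is dominating. -/
theorem SimpleGraph.IsMaxIndep.exists_adj {V : Type*} {G : SimpleGraph V} {s : Set V}
    (hs : G.IsMaxIndep s) {v : V} (hv : v ∉ s) : ∃ u ∈ s, G.Adj v u := by
  by_contra! h
  have hins : G.IsIndep (insert v s) :=
    hs.1.insert fun u hu _ => ⟨h u hu, fun e => h u hu e.symm⟩
  exact hv (hs.2 _ hins (Set.subset_insert v s) ▸ Set.mem_insert v s)

theorem stmt_6 {V : Type*} [Fintype V] (G : SimpleGraph V)
    (H : SimpleGraph (V ⊕ V))
    (hGG : ∀ a b : V, H.Adj (Sum.inl a) (Sum.inl b) ↔ G.Adj a b)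
    (hpend : ∀ a b : V, H.Adj (Sum.inl a) (Sum.inr b) ↔ a = b)
    (hnew : ∀ a b : V, ¬ H.Adj (Sum.inr a) (Sum.inr b)) :
    H.WellCovered ∧
      ∀ s : Set (V ⊕ V), H.IsMaxIndep s → s.ncard = Fintype.card V := by
  have card_eq (s : Set (V ⊕ V)) (hs : H.IsMaxIndep s) : s.ncard = Fintype.card V := by
    have not_both (a : V) (hl : Sum.inl a ∈ s) (hr : Sum.inr a ∈ s) : False :=
      hs.1 hl hr Sum.inl_ne_inr ((hpend a a).2 rfl)
    have hinj : Set.InjOn (Sum.elim id id : V ⊕ V → V) s := by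
      rintro (a | a) ha (b | b) hb hab <;> obtain rfl : a = b := hab
      · rfl
      · exact (not_both a ha hb).elim
      · exact (not_both a hb ha).elim
      · rfl
    have himage : (Sum.elim id id : V ⊕ V → V) '' s = Set.univ := by
      refine Set.eq_univ_of_forall fun a => ?_
      by_cases ha : Sum.inr a ∈ s
      · exact ⟨Sum.inr a, ha, rfl⟩
      · obtain ⟨b | b, hb, hab⟩ := hs.exists_adj ha
        · exact ⟨Sum.inl b, hb, (hpend b a).1 hab.symm⟩
        · exact (hnew a b hab).elim
    rw [← hinj.ncard_image, himage, Set.ncard_univ, Nat.card_eq_fintype_card]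
  exact ⟨fun s t hs ht => (card_eq s hs).trans (card_eq t ht).symm, card_eq⟩
end

section
/- Let G be a finite simple graph and let r, ℓ ≥ 0 be integers. Let H be the disjoint union of G and a complete graph on r+1 vertices. Then H is an (r, ℓ+1)-graph if and only if G is an (r, ℓ)-graph. -/
/-- An `(r, ℓ)`-partition is the same as a labelling of the vertices by the parts. -/
theorem SimpleGraph.isRLGraph_iff_exists_labelling {V : Type*} (G : SimpleGraph V) (r ℓ : ℕ) :
    G.IsRLGraph r ℓ ↔ ∃ f : V → Fin r ⊕ Fin ℓ,
      (∀ i u v, f u = Sum.inl i → f v = Sum.inl i → ¬ G.Adj u v) ∧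
      (∀ j u v, f u = Sum.inr j → f v = Sum.inr j → u ≠ v → G.Adj u v) := by
  constructor
  · rintro ⟨S, K, hS, hK, h⟩
    choose f hf _ using h
    refine ⟨f, fun i u v hu hv huv => ?_, fun j u v hu hv huv => ?_⟩
    · have hu' := hf u
      have hv' := hf v
      simp only [hu, hv, Sum.elim_inl] at hu' hv'
      exact hS i hu' hv' huv.ne huv
    · have hu' := hf u
      have hv' := hf v
      simp only [hu, hv, Sum.elim_inr] at hu' hv'
      exact hK j hu' hv' huv
  · rintro ⟨f, hS, hK⟩
    refine ⟨fun i => {v | f v = Sum.inl i}, fun j => {v | f v = Sum.inr j},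
      fun i u hu v hv _ => hS i u v hu hv, fun j u hu v hv huv => hK j u v hu hv huv,
      fun v => ⟨f v, ?_, ?_⟩⟩
    · cases h : f v <;> simp [h]
    · rintro (i | j) hp
      · exact Eq.symm hp
      · exact Eq.symm hp

theorem stmt_9 {V : Type*} [Fintype V] (G : SimpleGraph V) (r ℓ : ℕ)
    (H : SimpleGraph (V ⊕ Fin (r + 1)))
    (hGG : ∀ a b : V, H.Adj (Sum.inl a) (Sum.inl b) ↔ G.Adj a b)
    (hKK : ∀ a b : Fin (r + 1), H.Adj (Sum.inr a) (Sum.inr b) ↔ a ≠ b)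
    (hcross : ∀ (a : V) (b : Fin (r + 1)), ¬ H.Adj (Sum.inl a) (Sum.inr b)) :
    H.IsRLGraph r (ℓ + 1) ↔ G.IsRLGraph r ℓ := by
  rw [SimpleGraph.isRLGraph_iff_exists_labelling, SimpleGraph.isRLGraph_iff_exists_labelling]
  constructor
  · rintro ⟨f, hS, hK⟩
    obtain ⟨b, j, hb⟩ : ∃ b j, f (Sum.inr b) = Sum.inr j := by
      by_contra! hno
      have hleft : ∀ b, ∃ i, f (Sum.inr b) = Sum.inl i := by
        intro b
        cases h : f (Sum.inr b) with
        | inl i => exact ⟨i, rfl⟩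
        | inr j => exact absurd h (hno b j)
      choose c hc using hleft
      obtain ⟨x, y, hxy, hcxy⟩ := Fintype.exists_ne_map_eq_of_card_lt c (by simp)
      exact hS (c x) _ _ (hc x) (hcxy ▸ hc y) ((hKK x y).2 hxy)
    have hlabel : ∀ v, ∃ q : Fin r ⊕ Fin ℓ, f (Sum.inl v) = Sum.map id j.succAbove q := by
      intro v
      cases h : f (Sum.inl v) with
      | inl i => exact ⟨Sum.inl i, rfl⟩
      | inr k =>
        have hkj : k ≠ j := by
          rintro rfl
          exact hcross v b (hK k _ _ h hb Sum.inl_ne_inr)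
        obtain ⟨m, rfl⟩ := Fin.exists_succAbove_eq hkj
        exact ⟨Sum.inr m, rfl⟩
    choose g hg using hlabel
    refine ⟨g, fun i u v hu hv huv => ?_, fun k u v hu hv huv => ?_⟩
    · exact hS i (Sum.inl u) (Sum.inl v) (by simp [hg, hu]) (by simp [hg, hv]) ((hGG u v).2 huv)
    · exact (hGG u v).1 (hK (j.succAbove k) _ _ (by simp [hg, hu]) (by simp [hg, hv])
        (Sum.inl_injective.ne huv))
  · rintro ⟨f, hS, hK⟩
    refine ⟨Sum.elim (fun v => Sum.map id Fin.castSucc (f v)) fun _ => Sum.inr (Fin.last ℓ),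
      ?_, ?_⟩
    · rintro i (u | a) (v | b) hu hv
      · rw [hGG]
        cases hfu : f u <;> cases hfv : f v <;> simp [hfu, hfv] at hu hv
        exact hS i u v (by rw [hfu, hu]) (by rw [hfv, hv])
      all_goals simp at hu hv
    · rintro k (u | a) (v | b) hu hv huv
      · rw [hGG]
        cases hfu : f u with
        | inl i => simp [hfu] at hu
        | inr m =>
          cases hfv : f v with
          | inl i => simp [hfv] at hv
          | inr n =>
            simp only [hfu, hfv, Sum.elim_inl, Sum.map_inr, Sum.inr.injEq] at hu hv
            obtain rfl := Fin.castSucc_injective ℓ (hu.trans hv.symm)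
            exact hK m u v hfu hfv fun h => huv (congrArg Sum.inl h)
      · cases hfu : f u with
        | inl i => simp [hfu] at hu
        | inr m =>
          simp only [hfu, Sum.elim_inl, Sum.elim_inr, Sum.map_inr, Sum.inr.injEq] at hu hv
          exact absurd (hu.trans hv.symm) (Fin.castSucc_ne_last m)
      · cases hfv : f v with
        | inl i => simp [hfv] at hv
        | inr m =>
          simp only [hfv, Sum.elim_inl, Sum.elim_inr, Sum.map_inr, Sum.inr.injEq] at hu hv
          exact absurd (hv.trans hu.symm) (Fin.castSucc_ne_last m)
      · exact (hKK a b).2 fun h => huv (congrArg Sum.inr h)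
end

section
/- Let G be a finite simple graph with at least one vertex, let p be the cardinality of some maximal independent set of G, and let H be the join of G with an edgeless graph on p vertices (every new vertex is adjacent in H to every vertex of G). Then H is well-covered if and only if G is well-covered. -/
namespace SimpleGraph

variable {V W : Type*} {G : SimpleGraph V} {H : SimpleGraph (V ⊕ W)}

theorem IsMaxIndep.nonempty [Nonempty V] {s : Set V} (hs : G.IsMaxIndep s) : s.Nonempty := by
  by_contra! h
  subst h
  obtain ⟨v⟩ := ‹Nonempty V›
  exact Set.singleton_ne_empty v
    (hs.2 {v} (Set.pairwise_singleton _ _) (Set.empty_subset _)).symm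

theorem isIndep_image_inl (hG : ∀ a b : V, H.Adj (Sum.inl a) (Sum.inl b) ↔ G.Adj a b)
    {s : Set V} (hs : G.IsIndep s) : H.IsIndep (Sum.inl '' s) := by
  rintro _ ⟨a, ha, rfl⟩ _ ⟨b, hb, rfl⟩ hab
  rw [hG]
  exact hs ha hb fun h => hab (congrArg _ h)

theorem isIndep_preimage_inl (hG : ∀ a b : V, H.Adj (Sum.inl a) (Sum.inl b) ↔ G.Adj a b)
    {t : Set (V ⊕ W)} (ht : H.IsIndep t) : G.IsIndep (Sum.inl ⁻¹' t) := by
  intro a ha b hb hab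
  rw [← hG]
  exact ht ha hb fun h => hab (Sum.inl_injective h)

/-- In a join, an independent set meeting the left part is contained in it. -/
theorem IsIndep.image_preimage_inl (hjoin : ∀ (a : V) (b : W), H.Adj (Sum.inl a) (Sum.inr b))
    {t : Set (V ⊕ W)} (ht : H.IsIndep t) {a : V} (ha : Sum.inl a ∈ t) :
    Sum.inl '' (Sum.inl ⁻¹' t : Set V) = t := by
  rw [Set.image_preimage_eq_iff]
  rintro (x | b) hx
  · exact Set.mem_range_self x
  · exact (ht ha hx Sum.inl_ne_inr (hjoin a b)).elim

theorem IsMaxIndep.image_inl [Nonempty V]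
    (hG : ∀ a b : V, H.Adj (Sum.inl a) (Sum.inl b) ↔ G.Adj a b)
    (hjoin : ∀ (a : V) (b : W), H.Adj (Sum.inl a) (Sum.inr b))
    {s : Set V} (hs : G.IsMaxIndep s) : H.IsMaxIndep (Sum.inl '' s) := by
  refine ⟨isIndep_image_inl hG hs.1, fun t ht hst => ?_⟩
  obtain ⟨a, ha⟩ := hs.nonempty
  have hsub : s ⊆ Sum.inl ⁻¹' t := Set.image_subset_iff.mp hst
  rw [hs.2 _ (isIndep_preimage_inl hG ht) hsub, ht.image_preimage_inl hjoin (hsub ha)]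

/-- A maximal independent set of the join of `G` with an edgeless graph is either the whole
right part or a maximal independent set of `G`. -/
theorem IsMaxIndep.eq_range_inr_or_image_inl
    (hG : ∀ a b : V, H.Adj (Sum.inl a) (Sum.inl b) ↔ G.Adj a b)
    (hW : ∀ a b : W, ¬ H.Adj (Sum.inr a) (Sum.inr b))
    (hjoin : ∀ (a : V) (b : W), H.Adj (Sum.inl a) (Sum.inr b))
    {t : Set (V ⊕ W)} (ht : H.IsMaxIndep t) :
    t = Set.range Sum.inr ∨ ∃ s : Set V, G.IsMaxIndep s ∧ t = Sum.inl '' s := by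
  by_cases h : ∃ a : V, Sum.inl a ∈ t
  · obtain ⟨a, ha⟩ := h
    have himage := ht.1.image_preimage_inl hjoin ha
    refine .inr ⟨Sum.inl ⁻¹' t, ⟨isIndep_preimage_inl hG ht.1, fun u hu htu => ?_⟩, himage.symm⟩
    have htu' : t = Sum.inl '' u :=
      ht.2 _ (isIndep_image_inl hG hu) (himage ▸ Set.image_mono htu)
    rw [htu', Set.preimage_image_eq _ Sum.inl_injective]
  · refine .inl (ht.2 _ ?_ ?_)
    · rintro _ ⟨a, rfl⟩ _ ⟨b, rfl⟩ -
      exact hW a b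
    · rintro (a | b) hx
      · exact (h ⟨a, hx⟩).elim
      · exact Set.mem_range_self b

end SimpleGraph

theorem stmt_11 {V : Type*} [Fintype V] [Nonempty V] (G : SimpleGraph V)
    (I : Set V) (hI : G.IsMaxIndep I) (p : ℕ) (hp : p = I.ncard)
    (H : SimpleGraph (V ⊕ Fin p))
    (hGG : ∀ a b : V, H.Adj (Sum.inl a) (Sum.inl b) ↔ G.Adj a b)
    (hZZ : ∀ a b : Fin p, ¬ H.Adj (Sum.inr a) (Sum.inr b))
    (hjoin : ∀ (a : V) (b : Fin p), H.Adj (Sum.inl a) (Sum.inr b)) :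
    H.WellCovered ↔ G.WellCovered := by
  constructor
  · intro hH s t hs ht
    have h := hH _ _ (hs.image_inl hGG hjoin) (ht.image_inl hGG hjoin)
    rwa [Set.ncard_image_of_injective _ Sum.inl_injective,
      Set.ncard_image_of_injective _ Sum.inl_injective] at h
  · intro hG
    have hcard : ∀ t, H.IsMaxIndep t → t.ncard = p := by
      intro t ht
      obtain rfl | ⟨s, hs, rfl⟩ := ht.eq_range_inr_or_image_inl hGG hZZ hjoin
      · rw [← Set.image_univ, Set.ncard_image_of_injective _ Sum.inr_injective,
          Set.ncard_univ, Nat.card_fin]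
      · rw [Set.ncard_image_of_injective _ Sum.inl_injective, hp]
        exact hG s I hs hI
    intro s t hs ht
    rw [hcard s hs, hcard t ht]
end

section
/- Let G be a simple graph on vertex set {u_1, …, u_n} that has a maximal independent set of cardinality k, and set ℓ = k+1. Let G' be the simple graph on vertex set {(i,j) : 1 ≤ i ≤ ℓ, 1 ≤ j ≤ n} in which two distinct vertices (i,a) and (j,b) are adjacent if and only if a = b, or i = j, or u_a and u_b are adjacent in G. Then G' is well-covered if and only if G is well-covered. -/
theorem SimpleGraph.IsIndep.exists_isMaxIndep_superset {V : Type*} [Finite V]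
    {G : SimpleGraph V} {s : Set V} (hs : G.IsIndep s) : ∃ t, s ⊆ t ∧ G.IsMaxIndep t := by
  obtain ⟨t, hst, ht⟩ := Set.Finite.exists_le_maximal (Set.toFinite {t | G.IsIndep t}) hs
  exact ⟨t, hst, ht.prop, fun u hu htu => ht.eq_of_subset hu htu⟩

/-- The graph on `C × V` whose independent sets are the injectively `C`-coloured
independent sets of `G`. -/
def SimpleGraph.IsRookProduct {C V : Type*} (G : SimpleGraph V) (G' : SimpleGraph (C × V)) :
    Prop :=
  ∀ p q : C × V, G'.Adj p q ↔ p ≠ q ∧ (p.2 = q.2 ∨ p.1 = q.1 ∨ G.Adj p.2 q.2)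

namespace SimpleGraph.IsRookProduct

variable {C V : Type*} {G : SimpleGraph V} {G' : SimpleGraph (C × V)}

theorem isIndep_iff (h : G.IsRookProduct G') {S : Set (C × V)} :
    G'.IsIndep S ↔ S.InjOn Prod.fst ∧ S.InjOn Prod.snd ∧ G.IsIndep (Prod.snd '' S) := by
  constructor
  · intro hS
    refine ⟨fun p hp q hq e => ?_, fun p hp q hq e => ?_, ?_⟩
    · by_contra hne
      exact hS hp hq hne ((h p q).2 ⟨hne, Or.inr (Or.inl e)⟩)
    · by_contra hne
      exact hS hp hq hne ((h p q).2 ⟨hne, Or.inl e⟩)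
    · rintro _ ⟨p, hp, rfl⟩ _ ⟨q, hq, rfl⟩ hne hadj
      have hpq : p ≠ q := fun e => hne (congrArg Prod.snd e)
      exact hS hp hq hpq ((h p q).2 ⟨hpq, Or.inr (Or.inr hadj)⟩)
  · rintro ⟨h1, h2, h3⟩ p hp q hq hne hadj
    rcases ((h p q).1 hadj).2 with e | e | e
    · exact hne (h2 hp hq e)
    · exact hne (h1 hp hq e)
    · exact h3 ⟨p, hp, rfl⟩ ⟨q, hq, rfl⟩ (fun e => hne (h2 hp hq e)) e

theorem ncard_image_snd (h : G.IsRookProduct G') {S : Set (C × V)} (hS : G'.IsIndep S) :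
    (Prod.snd '' S).ncard = S.ncard :=
  (h.isIndep_iff.1 hS).2.1.ncard_image

theorem ncard_le [Finite C] (h : G.IsRookProduct G') {S : Set (C × V)} (hS : G'.IsIndep S) :
    S.ncard ≤ Nat.card C := by
  rw [← (h.isIndep_iff.1 hS).1.ncard_image, ← Set.ncard_univ]
  exact Set.ncard_le_ncard (Set.subset_univ _)

theorem exists_isIndep_image_snd_eq [Finite C] [Nonempty C] [Finite V]
    (h : G.IsRookProduct G') {T : Set V} (hT : G.IsIndep T) (hcard : T.ncard ≤ Nat.card C) :
    ∃ S, G'.IsIndep S ∧ Prod.snd '' S = T := by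
  have hle : T.encard ≤ (Set.univ : Set C).encard := by
    rw [← T.toFinite.cast_ncard_eq, ← (Set.toFinite (Set.univ : Set C)).cast_ncard_eq,
      Set.ncard_univ]
    exact_mod_cast hcard
  obtain ⟨f, -, hf⟩ := T.toFinite.exists_injOn_of_encard_le hle
  have himage : Prod.snd '' ((fun v => (f v, v)) '' T) = T := by
    simp [Set.image_image]
  refine ⟨(fun v => (f v, v)) '' T, h.isIndep_iff.2 ⟨?_, ?_, himage.symm ▸ hT⟩, himage⟩
  · rintro _ ⟨u, hu, rfl⟩ _ ⟨v, hv, rfl⟩ e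
    rw [hf hu hv e]
  · rintro _ ⟨u, -, rfl⟩ _ ⟨v, -, rfl⟩ e
    rw [show u = v from e]

theorem isMaxIndep_of_ncard_eq [Finite C] [Finite V] (h : G.IsRookProduct G')
    {S : Set (C × V)} (hS : G'.IsIndep S) (hcard : S.ncard = Nat.card C) : G'.IsMaxIndep S :=
  ⟨hS, fun _ ht hst => Set.eq_of_subset_of_ncard_le hst (hcard ▸ h.ncard_le ht)⟩

theorem isMaxIndep_of_image_snd [Finite C] [Finite V] (h : G.IsRookProduct G')
    {S : Set (C × V)} (hS : G'.IsIndep S) (hmax : G.IsMaxIndep (Prod.snd '' S)) :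
    G'.IsMaxIndep S := by
  refine ⟨hS, fun t ht hst => Set.eq_of_subset_of_ncard_le hst ?_⟩
  rw [← h.ncard_image_snd hS, ← h.ncard_image_snd ht,
    hmax.2 _ (h.isIndep_iff.1 ht).2.2 (Set.image_mono hst)]

theorem isMaxIndep_image_snd [Finite C] (h : G.IsRookProduct G')
    {S : Set (C × V)} (hS : G'.IsMaxIndep S) (hcard : S.ncard < Nat.card C) :
    G.IsMaxIndep (Prod.snd '' S) := by
  obtain ⟨h1, h2, h3⟩ := h.isIndep_iff.1 hS.1
  obtain ⟨c, hc⟩ : ∃ c, c ∉ Prod.fst '' S := by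
    by_contra! hall
    rw [← h1.ncard_image, Set.eq_univ_of_forall hall, Set.ncard_univ] at hcard
    exact hcard.false
  refine ⟨h3, fun t ht hst => hst.antisymm fun v hv => ?_⟩
  by_contra hvS
  have hins : G'.IsIndep (insert (c, v) S) := by
    have hnot : (c, v) ∉ S := fun hmem => hvS ⟨_, hmem, rfl⟩
    refine h.isIndep_iff.2
      ⟨(Set.injOn_insert hnot).2 ⟨h1, hc⟩, (Set.injOn_insert hnot).2 ⟨h2, hvS⟩, ?_⟩
    rw [Set.image_insert_eq]
    exact ht.mono (Set.insert_subset hv hst)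
  have heq := hS.2 _ hins (Set.subset_insert _ _)
  exact hvS ⟨(c, v), heq ▸ Set.mem_insert _ _, rfl⟩

end SimpleGraph.IsRookProduct

theorem stmt_18 {V : Type*} [Fintype V] (G : SimpleGraph V) (k : ℕ)
    (hk : ∃ I : Set V, G.IsMaxIndep I ∧ I.ncard = k)
    (G' : SimpleGraph (Fin (k + 1) × V))
    (hG' : ∀ p q : Fin (k + 1) × V,
      G'.Adj p q ↔ p ≠ q ∧ (p.2 = q.2 ∨ p.1 = q.1 ∨ G.Adj p.2 q.2)) :
    G'.WellCovered ↔ G.WellCovered := by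
  have h : G.IsRookProduct G' := hG'
  obtain ⟨I, hI, hIk⟩ := hk
  have hC : Nat.card (Fin (k + 1)) = k + 1 := Nat.card_fin _
  constructor
  · intro hwc
    have lift_max : ∀ J, G.IsMaxIndep J → J.ncard ≤ k →
        ∃ S, G'.IsMaxIndep S ∧ S.ncard = J.ncard := by
      intro J hJ hJk
      obtain ⟨S, hS, rfl⟩ := h.exists_isIndep_image_snd_eq hJ.1 (by lia)
      exact ⟨S, h.isMaxIndep_of_image_snd hS hJ, (h.ncard_image_snd hS).symm⟩
    obtain ⟨S, hS, hScard⟩ := lift_max I hI hIk.le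
    have key : ∀ J, G.IsMaxIndep J → J.ncard = k := by
      intro J hJ
      rcases le_or_gt J.ncard k with hle | hlt
      · obtain ⟨S', hS', hScard'⟩ := lift_max J hJ hle
        rw [← hScard', hwc S' S hS' hS, hScard, hIk]
      · obtain ⟨T, hTJ, hT⟩ := Set.exists_subset_card_eq (Nat.succ_le_of_lt hlt)
        obtain ⟨S', hS', rfl⟩ := h.exists_isIndep_image_snd_eq (hJ.1.mono hTJ) (by lia)
        rw [h.ncard_image_snd hS'] at hT
        have := hwc S' S (h.isMaxIndep_of_ncard_eq hS' (by lia)) hS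
        lia
    intro s t hs ht
    rw [key s hs, key t ht]
  · intro hwc
    have key : ∀ S, G'.IsMaxIndep S → S.ncard = k := by
      intro S hS
      obtain ⟨t, hSt, ht⟩ := (h.isIndep_iff.1 hS.1).2.2.exists_isMaxIndep_superset
      have hle := Set.ncard_le_ncard hSt
      rw [h.ncard_image_snd hS.1, hwc t I ht hI, hIk] at hle
      rw [← h.ncard_image_snd hS.1]
      exact (hwc _ _ (h.isMaxIndep_image_snd hS (by lia)) hI).trans hIk
    intro s t hs ht
    rw [key s hs, key t ht]
end
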